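/- Let k be a positive integer and let ε > 0. If t = t(n) and b = b(n) satisfy t ≥ (1+ε)·n·log n/2 and b ≥ (1+ε)·k·n/2, then there exists a (t,b)-strategy B of Builder such that the probability that the purchased graph B_t has minimum degree at least k tends to 1 as n → ∞. -/

import Mathlib

open Filter

attribute [local instance] Classical.propDecidable

/-- The edges of the complete graph on `Fin n`: non-diagonal unordered pairs. -/
abbrev CEdge (n : ℕ) : Type := {e : Sym2 (Fin n) // ¬ e.IsDiag}

/-- The sample space: a uniformly random ordering of the edges of `K_n`,
encoded as a bijection from positions to edges. -/
abbrev EdgeOrdering (n : ℕ) : Type := Fin (Fintype.card (CEdge n)) ≃ CEdge n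

/-- The uniform probability of an event on a finite sample space. -/
noncomputable def uprob {α : Type} [Fintype α] (P : α → Prop) : ℝ :=
  ((Finset.univ.filter P).card : ℝ) / (Fintype.card α : ℝ)

/-- A (deterministic) strategy of Builder: given the current time `s`, the graph `B_{s-1}`
of previously purchased edges, and the observed edge `e_s`, decide whether to purchase it. -/
def Strategy (n : ℕ) : Type := ℕ → Finset (CEdge n) → CEdge n → Bool

/-- Builder's purchased graph `B_s` at time `s`, playing strategy `S` with budget `b`
on the ordering `ω`.  An edge is purchased iff the strategy accepts it and the budget permits. -/
noncomputable def build (n b : ℕ) (S : Strategy n) (ω : EdgeOrdering n) : ℕ → Finset (CEdge n)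
  | 0 => ∅
  | s + 1 =>
    let P := build n b S ω s
    if h : s < Fintype.card (CEdge n) then
      if S s P (ω ⟨s, h⟩) = true ∧ P.card < b then insert (ω ⟨s, h⟩) P else P
    else P

/-- The degree of the vertex `v` in the graph given by the edge set `P`. -/
noncomputable def edegree (n : ℕ) (P : Finset (CEdge n)) (v : Fin n) : ℕ :=
  (P.filter (fun e => v ∈ (e : Sym2 (Fin n)))).card

section Hits

variable {α β : Type}

/-- The number of positions in `I` that the ordering `ω` maps into `F`. -/
noncomputable def hits (F : Finset β) (I : Finset α) (ω : α ≃ β) : ℕ :=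
  (I.filter (fun i => ω i ∈ F)).card

/-- The weight `x ^ hits`, truncated to orderings with fewer than `r` hits. -/
noncomputable def hitWeight (F : Finset β) (r : ℕ) (x : ℝ) (I : Finset α) (ω : α ≃ β) : ℝ :=
  if hits F I ω < r then x ^ hits F I ω else 0

lemma hitWeight_nonneg (F : Finset β) (r : ℕ) {x : ℝ} (hx : 0 ≤ x) (I : Finset α) (ω : α ≃ β) :
    0 ≤ hitWeight F r x I ω := by
  unfold hitWeight
  split_ifs <;> positivity

lemma hits_insert (F : Finset β) {I : Finset α} {i : α} (hi : i ∉ I) (ω : α ≃ β) :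
    hits F (insert i I) ω = hits F I ω + if ω i ∈ F then 1 else 0 := by
  unfold hits
  rw [Finset.filter_insert]
  split_ifs with h
  · rw [Finset.card_insert_of_notMem (by simp [hi])]
  · rfl

lemma hitWeight_insert_le (F : Finset β) (r : ℕ) {x : ℝ} (hx : 0 ≤ x) {I : Finset α} {i : α}
    (hi : i ∉ I) (ω : α ≃ β) :
    hitWeight F r x (insert i I) ω ≤
      hitWeight F r x I ω - (1 - x) * (hitWeight F r x I ω * if ω i ∈ F then 1 else 0) := by
  have h0 := hitWeight_nonneg F r hx I ω
  unfold hitWeight at *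
  rw [hits_insert F hi]
  by_cases h : ω i ∈ F
  · by_cases h1 : hits F I ω + 1 < r
    · have h2 : hits F I ω < r := by omega
      simp only [h, h1, h2, if_true, pow_succ]
      linarith
    · simp only [h, h1, if_true, if_false]
      nlinarith
  · simp [h]

lemma hitWeight_swap (F : Finset β) (r : ℕ) (x : ℝ) {I : Finset α} {i j : α}
    (hi : i ∉ I) (hj : j ∉ I) (ω : α ≃ β) :
    hitWeight F r x I ((Equiv.swap i j).trans ω) = hitWeight F r x I ω := by
  have : hits F I ((Equiv.swap i j).trans ω) = hits F I ω := by
    unfold hits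
    congr 1
    apply Finset.filter_congr
    intro a ha
    rw [Equiv.trans_apply, Equiv.swap_apply_of_ne_of_ne]
    · rintro rfl; exact hi ha
    · rintro rfl; exact hj ha
  unfold hitWeight
  rw [this]

lemma sum_hitWeight_mem_eq [Fintype (α ≃ β)] (F : Finset β) (r : ℕ) (x : ℝ) {I : Finset α} {i j : α}
    (hi : i ∉ I) (hj : j ∉ I) :
    (∑ ω : α ≃ β, hitWeight F r x I ω * if ω j ∈ F then 1 else 0) =
      ∑ ω : α ≃ β, hitWeight F r x I ω * if ω i ∈ F then 1 else 0 := by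
  rw [← Equiv.sum_comp (Equiv.equivCongr (Equiv.swap i j) (Equiv.refl β))]
  refine Finset.sum_congr rfl fun ω _ => ?_
  have : Equiv.equivCongr (Equiv.swap i j) (Equiv.refl β) ω = (Equiv.swap i j).trans ω := by
    ext a; simp [Equiv.equivCongr]
  rw [this, hitWeight_swap F r x hi hj]
  simp

variable [Fintype α] [Fintype β]

lemma sum_compl_mem_eq (F : Finset β) (I : Finset α) (ω : α ≃ β) :
    (∑ j ∈ Iᶜ, if ω j ∈ F then (1 : ℝ) else 0) = F.card - hits F I ω := by
  have h1 : (∑ j, if ω j ∈ F then (1 : ℝ) else 0) = F.card := by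
    rw [Equiv.sum_comp ω (fun e => if e ∈ F then (1 : ℝ) else 0)]
    simp
  have h2 : (∑ j ∈ I, if ω j ∈ F then (1 : ℝ) else 0) = hits F I ω := by
    simp [hits]
  rw [← h1, ← h2, ← Finset.sum_add_sum_compl I]
  ring

variable [Fintype (α ≃ β)]

lemma sum_hitWeight_insert_le (F : Finset β) (r : ℕ) {x : ℝ} (hx : 0 ≤ x)
    (hx1 : x ≤ 1) {I : Finset α} {i : α} (hi : i ∉ I) :
    ∑ ω : α ≃ β, hitWeight F r x (insert i I) ω ≤
      (1 - (1 - x) * (F.card - r) / Fintype.card α) * ∑ ω : α ≃ β, hitWeight F r x I ω := by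
  set c := ∑ ω : α ≃ β, hitWeight F r x I ω * if ω i ∈ F then (1 : ℝ) else 0 with hc
  set W := ∑ ω : α ≃ β, hitWeight F r x I ω with hW
  have hc0 : 0 ≤ c := Finset.sum_nonneg fun ω _ =>
    mul_nonneg (hitWeight_nonneg F r hx I ω) (by split_ifs <;> norm_num)
  have hN : (0 : ℝ) < Fintype.card α := by
    exact_mod_cast Fintype.card_pos_iff.2 ⟨i⟩
  have hle : ∑ ω : α ≃ β, hitWeight F r x (insert i I) ω ≤ W - (1 - x) * c := by
    rw [hW, hc, Finset.mul_sum, ← Finset.sum_sub_distrib]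
    exact Finset.sum_le_sum fun ω _ => hitWeight_insert_le F r hx hi ω
  have hsum : ((Iᶜ : Finset α).card : ℝ) * c =
      ∑ ω : α ≃ β, hitWeight F r x I ω * (F.card - hits F I ω) := by
    rw [← nsmul_eq_mul, ← Finset.sum_const]
    rw [Finset.sum_congr rfl fun j hj =>
      (sum_hitWeight_mem_eq F r x hi (Finset.mem_compl.1 hj)).symm, Finset.sum_comm]
    refine Finset.sum_congr rfl fun ω _ => ?_
    rw [← Finset.mul_sum, sum_compl_mem_eq]
  have hge : (F.card - r : ℝ) * W ≤ Fintype.card α * c := by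
    calc (F.card - r : ℝ) * W ≤ ∑ ω : α ≃ β, hitWeight F r x I ω * (F.card - hits F I ω) := by
          rw [hW, Finset.mul_sum]
          refine Finset.sum_le_sum fun ω _ => ?_
          unfold hitWeight
          split_ifs with h
          · have : (hits F I ω : ℝ) ≤ r := by exact_mod_cast h.le
            rw [mul_comm]
            gcongr
          · simp
      _ = ((Iᶜ : Finset α).card : ℝ) * c := hsum.symm
      _ ≤ _ := by
          gcongr
          exact Finset.card_le_univ _
  have : (F.card - r : ℝ) / Fintype.card α * W ≤ c := by
    rw [div_mul_eq_mul_div, div_le_iff₀ hN]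
    linarith
  have hx_compl : 0 ≤ 1 - x := by linarith
  calc _ ≤ W - (1 - x) * c := hle
    _ ≤ W - (1 - x) * ((F.card - r : ℝ) / Fintype.card α * W) := by gcongr
    _ = _ := by ring

lemma sum_hitWeight_le (e : α ≃ β) (F : Finset β) {r : ℕ} (hr : r ≤ F.card) {x : ℝ} (hx : 0 ≤ x)
    (hx1 : x ≤ 1) (I : Finset α) :
    ∑ ω : α ≃ β, hitWeight F r x I ω ≤
      (1 - (1 - x) * (F.card - r) / Fintype.card α) ^ I.card * Fintype.card (α ≃ β) := by
  have hr' : (r : ℝ) ≤ F.card := by exact_mod_cast hr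
  have hF : (F.card : ℝ) ≤ Fintype.card α := by
    rw [Fintype.card_congr e]; exact_mod_cast Finset.card_le_univ F
  have hfac : 0 ≤ 1 - (1 - x) * (F.card - r) / Fintype.card α := by
    have hr0 : (0 : ℝ) ≤ r := by positivity
    have : (1 - x) * (F.card - r) / Fintype.card α ≤ 1 :=
      div_le_one_of_le₀ (by nlinarith) (by positivity)
    linarith
  induction I using Finset.induction_on with
  | empty =>
    rw [Finset.card_empty, pow_zero, one_mul, ← nsmul_one, ← Finset.card_univ, ← Finset.sum_const]
    refine Finset.sum_le_sum fun ω _ => ?_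
    unfold hitWeight hits
    simp only [Finset.filter_empty, Finset.card_empty, pow_zero]
    split_ifs <;> norm_num
  | insert i I hi ih =>
    rw [Finset.card_insert_of_notMem hi, pow_succ']
    refine (sum_hitWeight_insert_le F r hx hx1 hi).trans ?_
    rw [mul_assoc]
    gcongr

/-- A lower tail bound for the hypergeometric distribution. -/
lemma uprob_hits_lt_le (e : α ≃ β) (F : Finset β) {r : ℕ} (hr : r ≤ F.card) {x : ℝ} (hx : 0 < x)
    (hx1 : x ≤ 1) (I : Finset α) :
    uprob (fun ω : α ≃ β => hits F I ω < r) ≤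
      (x ^ r)⁻¹ * Real.exp (-((1 - x) * (F.card - r) / Fintype.card α * I.card)) := by
  have hpos : (0 : ℝ) < Fintype.card (α ≃ β) := by
    exact_mod_cast Fintype.card_pos_iff.2 ⟨e⟩
  have hr' : (r : ℝ) ≤ F.card := by exact_mod_cast hr
  have hF : (F.card : ℝ) ≤ Fintype.card α := by
    rw [Fintype.card_congr e]; exact_mod_cast Finset.card_le_univ F
  have hfac : 0 ≤ 1 - (1 - x) * (F.card - r) / Fintype.card α := by
    have hr0 : (0 : ℝ) ≤ r := by positivity
    have : (1 - x) * (F.card - r) / Fintype.card α ≤ 1 :=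
      div_le_one_of_le₀ (by nlinarith) (by positivity)
    linarith
  unfold uprob
  rw [div_le_iff₀ hpos, mul_assoc, ← div_eq_inv_mul, le_div_iff₀ (by positivity)]
  calc _ ≤ ∑ ω : α ≃ β, hitWeight F r x I ω := by
        rw [Finset.card_filter, Nat.cast_sum, Finset.sum_mul]
        refine Finset.sum_le_sum fun ω _ => ?_
        unfold hitWeight
        split_ifs with h
        · simpa using pow_le_pow_of_le_one hx.le hx1 h.le
        · simp
    _ ≤ _ := sum_hitWeight_le e F hr hx.le hx1 I
    _ ≤ _ := by
        refine mul_le_mul_of_nonneg_right ?_ hpos.le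
        rw [neg_mul_eq_neg_mul, mul_comm _ (I.card : ℝ), Real.exp_nat_mul]
        gcongr
        have := Real.add_one_le_exp (-((1 - x) * (F.card - r) / Fintype.card α))
        linarith

end Hits

lemma uprob_or_le {α : Type} [Fintype α] (P Q : α → Prop) :
    uprob (fun a => P a ∨ Q a) ≤ uprob P + uprob Q := by
  unfold uprob
  rw [← add_div]
  gcongr
  exact_mod_cast (Finset.card_le_card (t := Finset.univ.filter P ∪ Finset.univ.filter Q)
    fun a ha => by simpa using ha).trans (Finset.card_union_le _ _)

lemma uprob_exists_le {α ι : Type} [Fintype α] (s : Finset ι) (P : ι → α → Prop) {c : ℝ}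
    (h : ∀ i ∈ s, uprob (P i) ≤ c) :
    uprob (fun a => ∃ i ∈ s, P i a) ≤ s.card * c := by
  have : uprob (fun a => ∃ i ∈ s, P i a) ≤ ∑ i ∈ s, uprob (P i) := by
    unfold uprob
    rw [← Finset.sum_div]
    gcongr
    exact_mod_cast (Finset.card_le_card (t := s.biUnion fun i => Finset.univ.filter (P i))
      fun a ha => by simpa using ha).trans Finset.card_biUnion_le
  refine this.trans ((Finset.sum_le_sum h).trans ?_)
  simp

lemma one_sub_uprob_le {α : Type} [Fintype α] [Nonempty α] {P Q : α → Prop}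
    (h : ∀ a, ¬ Q a → P a) : 1 - uprob Q ≤ uprob P := by
  have hpos : (0 : ℝ) < Fintype.card α := by exact_mod_cast Fintype.card_pos
  unfold uprob
  rw [sub_le_iff_le_add, ← add_div, le_div_iff₀ hpos, one_mul]
  have : (Finset.univ : Finset α) ⊆ Finset.univ.filter P ∪ Finset.univ.filter Q := by
    intro a _
    by_cases hq : Q a
    · simp [hq]
    · simp [h a hq]
  exact_mod_cast (Finset.card_le_card this).trans (Finset.card_union_le _ _)

lemma uprob_le_one {α : Type} [Fintype α] (P : α → Prop) : uprob P ≤ 1 :=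
  div_le_one_of_le₀ (by exact_mod_cast Finset.card_le_univ _) (by positivity)

section Degree

variable {n : ℕ}

lemma edegree_eq (P : Finset (CEdge n)) (v : Fin n) :
    edegree n P v = (P.filter fun e : CEdge n => v ∈ e.1).card := by
  unfold edegree
  rw [← Finset.card_map (Function.Embedding.subtype _)]
  congr 1
  ext e
  simp [Finset.bind_def]

lemma edegree_mono {P Q : Finset (CEdge n)} (h : P ⊆ Q) (v : Fin n) :
    edegree n P v ≤ edegree n Q v := by
  rw [edegree_eq, edegree_eq]
  exact Finset.card_le_card (Finset.filter_subset_filter _ h)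

lemma edegree_insert {P : Finset (CEdge n)} {e : CEdge n} (he : e ∉ P) (v : Fin n) :
    edegree n (insert e P) v = edegree n P v + if v ∈ (e : Sym2 (Fin n)) then 1 else 0 := by
  rw [edegree_eq, edegree_eq, Finset.filter_insert]
  split_ifs with h
  · rw [Finset.card_insert_of_notMem (by simp [he])]
  · rfl

lemma card_filter_mem_edge (e : CEdge n) :
    (Finset.univ.filter fun v : Fin n => v ∈ (e : Sym2 (Fin n))).card = 2 := by
  rw [← Sym2.card_toFinset_of_not_isDiag _ e.2]
  congr 1
  ext v
  simp

lemma sum_edegree (P : Finset (CEdge n)) : ∑ v, edegree n P v = 2 * P.card := by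
  simp_rw [edegree_eq, Finset.card_filter]
  rw [Finset.sum_comm]
  simp_rw [← Finset.card_filter]
  rw [Finset.sum_congr rfl fun e _ => card_filter_mem_edge e]
  simp [mul_comm]

/-- The edges with both endpoints in `U`. -/
noncomputable def edgesIn (U : Finset (Fin n)) : Finset (CEdge n) :=
  Finset.univ.filter fun e => ∀ v ∈ (e : Sym2 (Fin n)), v ∈ U

/-- The edges incident to `v`. -/
noncomputable def edgesAt (v : Fin n) : Finset (CEdge n) :=
  Finset.univ.filter fun e => v ∈ (e : Sym2 (Fin n))

/-- The total number of edge endpoints missing for all degrees to be at least `k`. -/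
noncomputable def deficit (k : ℕ) (P : Finset (CEdge n)) : ℕ := ∑ v, (k - edegree n P v)

lemma deficit_insert_lt {k : ℕ} {P : Finset (CEdge n)} {e : CEdge n} (he : e ∉ P)
    (h : ∃ v ∈ (e : Sym2 (Fin n)), edegree n P v < k) :
    deficit k (insert e P) < deficit k P := by
  obtain ⟨v, hv, hlt⟩ := h
  refine Finset.sum_lt_sum (fun w _ => ?_) ⟨v, Finset.mem_univ v, ?_⟩
  · have := edegree_mono (Finset.subset_insert e P) w
    omega
  · rw [edegree_insert he, if_pos hv]
    omega

lemma deficit_pos {k : ℕ} {P : Finset (CEdge n)} (h : ∃ v, edegree n P v < k) :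
    0 < deficit k P := by
  obtain ⟨v, hlt⟩ := h
  exact Finset.sum_pos' (fun _ _ => Nat.zero_le _) ⟨v, Finset.mem_univ v, by omega⟩

end Degree

/-- Until time `t₁`, accept the edges joining two vertices of degree less than `k`; afterwards,
accept the edges having at least one endpoint of degree less than `k`. -/
noncomputable def twoPhase (n k t₁ : ℕ) : Strategy n := fun s P e =>
  decide (if s < t₁ then ∀ v ∈ (e : Sym2 (Fin n)), edegree n P v < k
    else ∃ v ∈ (e : Sym2 (Fin n)), edegree n P v < k)

/-- The positions from `s` (inclusive) to `t` (exclusive). -/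
def window (N s t : ℕ) : Finset (Fin N) := Finset.univ.filter fun i => s ≤ i.val ∧ i.val < t

lemma card_window {N s t : ℕ} (ht : t ≤ N) : (window N s t).card = t - s := by
  rw [← Nat.card_Ico, ← Finset.card_map Fin.valEmbedding]
  congr 1
  ext j
  simp only [window, Finset.mem_map, Finset.mem_filter, Finset.mem_univ, true_and,
    Fin.valEmbedding_apply, Finset.mem_Ico]
  constructor
  · rintro ⟨i, hi, rfl⟩
    exact hi
  · intro h
    exact ⟨⟨j, by omega⟩, h, rfl⟩

section Build

variable {n b : ℕ} {S : Strategy n} {ω : EdgeOrdering n}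

lemma build_succ_cases (s : ℕ) :
    build n b S ω (s + 1) = build n b S ω s ∨
      ∃ h : s < Fintype.card (CEdge n), S s (build n b S ω s) (ω ⟨s, h⟩) = true ∧
        ω ⟨s, h⟩ ∉ build n b S ω s ∧
        build n b S ω (s + 1) = insert (ω ⟨s, h⟩) (build n b S ω s) := by
  simp only [build]
  split_ifs with h1 h2
  · by_cases h3 : ω ⟨s, h1⟩ ∈ build n b S ω s
    · left
      exact Finset.insert_eq_of_mem h3
    · right
      exact ⟨h1, h2.1, h3, rfl⟩
  · left; rfl
  · left; rfl

lemma build_mono : Monotone (build n b S ω) := by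
  refine monotone_nat_of_le_succ fun s => ?_
  obtain h | ⟨h, -, -, h'⟩ := build_succ_cases (b := b) (S := S) (ω := ω) s
  · exact h.ge
  · rw [h']
    exact Finset.subset_insert _ _

lemma mem_build_of_accept {i : Fin (Fintype.card (CEdge n))} {t : ℕ} (hit : i.val < t)
    (hS : S i (build n b S ω i) (ω i) = true) (hb : (build n b S ω i).card < b) :
    ω i ∈ build n b S ω t := by
  refine build_mono (Nat.succ_le_of_lt hit) ?_
  rw [build, dif_pos i.isLt, if_pos ⟨hS, hb⟩]
  exact Finset.mem_insert_self _ _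

lemma hits_le_card {F Q : Finset (CEdge n)} {I : Finset (Fin (Fintype.card (CEdge n)))}
    (h : ∀ i ∈ I, ω i ∈ F → ω i ∈ Q) : hits F I ω ≤ Q.card := by
  unfold hits
  refine Finset.card_le_card_of_injOn ω (fun i hi => ?_) ω.injective.injOn
  simp only [Finset.coe_filter, Set.mem_ofPred_eq] at hi
  exact h i hi.1 hi.2

variable {k t₁ : ℕ}

lemma edegree_build_twoPhase_le (s : ℕ) (hs : s ≤ t₁) (v : Fin n) :
    edegree n (build n b (twoPhase n k t₁) ω s) v ≤ k := by
  induction s with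
  | zero => simp [build, edegree]
  | succ s ih =>
    obtain h | ⟨h, hS, hmem, h'⟩ :=
      build_succ_cases (b := b) (S := twoPhase n k t₁) (ω := ω) s
    · rw [h]
      exact ih (by omega)
    · rw [h', edegree_insert hmem]
      have hlt : s < t₁ := hs
      simp only [twoPhase, hlt, if_true, decide_eq_true_eq] at hS
      split_ifs with hv
      · exact hS v hv
      · exact ih (by omega)

lemma card_build_twoPhase_le (s : ℕ) (hs : s ≤ t₁) :
    2 * (build n b (twoPhase n k t₁) ω s).card ≤ n * k := by
  rw [← sum_edegree]
  refine (Finset.sum_le_sum fun v _ => edegree_build_twoPhase_le s hs v).trans ?_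
  simp

lemma two_mul_hits_le (hb : n * k < 2 * b) {U : Finset (Fin n)}
    (hU : ∀ v ∈ U, edegree n (build n b (twoPhase n k t₁) ω t₁) v < k) :
    2 * hits (edgesIn U) (window _ 0 t₁) ω ≤ U.card * k := by
  set P := build n b (twoPhase n k t₁) ω t₁ with hP
  have h1 : hits (edgesIn U) (window _ 0 t₁) ω ≤ (P.filter (· ∈ edgesIn U)).card := by
    refine hits_le_card fun i hi hiU => ?_
    simp only [window, Finset.mem_filter, Finset.mem_univ, true_and] at hi
    refine Finset.mem_filter.2 ⟨?_, hiU⟩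
    refine mem_build_of_accept hi.2 ?_ ?_
    · simp only [twoPhase, hi.2, if_true, decide_eq_true_eq]
      intro v hv
      refine (edegree_mono (build_mono hi.2.le) v).trans_lt (hU v ?_)
      exact (Finset.mem_filter.1 hiU).2 v hv
    · have := card_build_twoPhase_le (b := b) (k := k) (ω := ω) i hi.2.le
      omega
  refine (Nat.mul_le_mul_left 2 h1).trans ?_
  rw [← sum_edegree]
  calc _ ≤ ∑ v, if v ∈ U then k else 0 := by
        refine Finset.sum_le_sum fun v _ => ?_
        split_ifs with hv
        · exact (edegree_mono (Finset.filter_subset _ _) v).trans (hU v hv).le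
        · rw [Nat.le_zero, edegree_eq, Finset.card_eq_zero, Finset.filter_eq_empty_iff]
          intro e he hve
          exact hv ((Finset.mem_filter.1 (Finset.mem_filter.1 he).2).2 v hve)
    _ = U.card * k := by simp

lemma card_add_deficit_le {s : ℕ} (hs : t₁ ≤ s) :
    (build n b (twoPhase n k t₁) ω s).card + deficit k (build n b (twoPhase n k t₁) ω s) ≤
      (build n b (twoPhase n k t₁) ω t₁).card +
        deficit k (build n b (twoPhase n k t₁) ω t₁) := by
  induction s, hs using Nat.le_induction with
  | base => exact le_rfl
  | succ s hs ih =>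
    obtain h | ⟨h, hS, hmem, h'⟩ :=
      build_succ_cases (b := b) (S := twoPhase n k t₁) (ω := ω) s
    · rw [h]
      exact ih
    · rw [h', Finset.card_insert_of_notMem hmem]
      simp only [twoPhase, hs.not_gt, if_false, decide_eq_true_eq] at hS
      have := deficit_insert_lt hmem hS
      omega

/-- The two-phase strategy succeeds if every set of `m` vertices receives many edges before time
`t₁` and every vertex receives many edges between times `t₁` and `T`. -/
lemma le_edegree_build_twoPhase {m T : ℕ} (hk : 0 < k) (hm : 0 < m)
    (hb : n * k + 2 * (m * k) ≤ 2 * b)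
    (h1 : ∀ U ∈ Finset.powersetCard m (Finset.univ : Finset (Fin n)),
      ¬ hits (edgesIn U) (window _ 0 t₁) ω < m * k)
    (h2 : ∀ v ∈ (Finset.univ : Finset (Fin n)), ¬ hits (edgesAt v) (window _ t₁ T) ω < k)
    (v : Fin n) : k ≤ edegree n (build n b (twoPhase n k t₁) ω T) v := by
  have hmk : 0 < m * k := Nat.mul_pos hm hk
  set P := build n b (twoPhase n k t₁) ω t₁ with hP
  have hdef : deficit k P ≤ m * k := by
    set U := Finset.univ.filter fun v => edegree n P v < k with hU
    have hUm : U.card ≤ m := by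
      by_contra! hlt
      obtain ⟨V, hVU, hV⟩ := Finset.exists_subset_card_eq hlt.le
      have := two_mul_hits_le (k := k) (t₁ := t₁) (ω := ω) (b := b) (U := V) (by omega)
        fun v hv => (Finset.mem_filter.1 (hVU hv)).2
      have := h1 V (Finset.mem_powersetCard.2 ⟨Finset.subset_univ _, hV⟩)
      rw [hV] at *
      omega
    calc deficit k P ≤ ∑ v, if v ∈ U then k else 0 := by
          refine Finset.sum_le_sum fun v _ => ?_
          split_ifs with hv
          · omega
          · have : ¬ edegree n P v < k := fun h => hv (by simp [hU, h])
            omega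
      _ = U.card * k := by simp
      _ ≤ m * k := Nat.mul_le_mul_right k hUm
  have hcard := card_build_twoPhase_le (b := b) (k := k) (ω := ω) t₁ le_rfl
  by_contra! hlt
  refine h2 v (Finset.mem_univ v) (lt_of_le_of_lt ?_ hlt)
  rw [edegree_eq]
  refine hits_le_card fun i hi hiv => ?_
  simp only [window, edgesAt, Finset.mem_filter, Finset.mem_univ, true_and] at hi hiv
  have hdeg : edegree n (build n b (twoPhase n k t₁) ω i) v < k :=
    (edegree_mono (build_mono hi.2.le) v).trans_lt hlt
  refine Finset.mem_filter.2 ⟨mem_build_of_accept hi.2 ?_ ?_, hiv⟩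
  · simp only [twoPhase, hi.1.not_gt, if_false, decide_eq_true_eq]
    exact ⟨v, hiv, hdeg⟩
  · have h3 := card_add_deficit_le (b := b) (k := k) (ω := ω) hi.1
    have h4 := deficit_pos ⟨v, hdeg⟩
    rw [← hP] at h3 hcard
    omega

end Build

lemma card_cedge (n : ℕ) : Fintype.card (CEdge n) = n.choose 2 := by
  simpa using Sym2.card_subtype_not_diag (α := Fin n)

lemma card_edgesIn {n : ℕ} (U : Finset (Fin n)) : (edgesIn U).card = U.card.choose 2 := by
  rw [← Sym2.card_image_offDiag, ← Finset.card_map (Function.Embedding.subtype _)]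
  congr 1
  ext e
  induction e using Sym2.ind with
  | _ a b =>
    simp only [edgesIn, Finset.mem_map, Finset.mem_filter, Finset.mem_univ, true_and,
      Function.Embedding.subtype_apply, Finset.mem_image, Finset.mem_offDiag, Subtype.exists]
    constructor
    · rintro ⟨e, hd, he, rfl⟩
      exact ⟨(a, b), ⟨he a (by simp), he b (by simp), by simpa using hd⟩, rfl⟩
    · rintro ⟨⟨c, d⟩, ⟨hc, hd, hne⟩, h⟩
      rw [← h]
      refine ⟨s(c, d), by simpa using hne, ?_, rfl⟩
      simp [hc, hd]

lemma card_edgesAt {n : ℕ} (v : Fin n) : (edgesAt v).card = n - 1 := by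
  have h : ((Finset.univ.erase v).image fun w => s(v, w)).card = n - 1 := by
    rw [Finset.card_image_of_injective _ fun a b h => Sym2.congr_right.1 h]
    simp
  rw [← h, ← Finset.card_map (Function.Embedding.subtype _)]
  congr 1
  ext e
  simp only [edgesAt, Finset.mem_map, Finset.mem_filter, Finset.mem_univ, true_and,
    Function.Embedding.subtype_apply, Finset.mem_image, Finset.mem_erase, and_true,
    Subtype.exists]
  constructor
  · rintro ⟨e, hd, he, rfl⟩
    obtain ⟨w, rfl⟩ := Sym2.mem_iff_exists.1 he
    exact ⟨w, fun h => hd (by simp [h]), rfl⟩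
  · rintro ⟨w, hw, rfl⟩
    exact ⟨s(v, w), by simpa using Ne.symm hw, by simp, rfl⟩

lemma cast_card_cedge (n : ℕ) : (Fintype.card (CEdge n) : ℝ) = n * (n - 1) / 2 := by
  rw [card_cedge, Nat.cast_choose_two]

/-- Every set of `m` vertices receives at least `m * k` of the first `t₁` edges, with probability
exponentially close to one. -/
lemma uprob_hits_edgesIn_le {n m k t₁ : ℕ} {ε : ℝ} (hε : 0 < ε) (hn : 2 ≤ n)
    (hmε : (m : ℝ) ≤ ε * n / 2) (hm : ε * n / 4 ≤ m) (hmk : 4 * k + 2 ≤ m)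
    (ht₁ : ε / 4 * (n * Real.log n) ≤ t₁) (htN : t₁ ≤ Fintype.card (CEdge n))
    (hlog : 2 + k * ε / 2 ≤ ε ^ 3 / 256 * Real.log n) :
    uprob (fun ω : EdgeOrdering n => ∃ U ∈ Finset.powersetCard m (Finset.univ : Finset (Fin n)),
      hits (edgesIn U) (window _ 0 t₁) ω < m * k) ≤ Real.exp (-n) := by
  have hn' : (2 : ℝ) ≤ n := by exact_mod_cast hn
  have hmk' : (4 * k + 2 : ℝ) ≤ m := by exact_mod_cast hmk
  have hk0 : (0 : ℝ) ≤ k := by positivity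
  have hchoose : ((m.choose 2 : ℕ) : ℝ) = m * (m - 1) / 2 := Nat.cast_choose_two ℝ m
  have hgap : (ε * n) ^ 2 / 64 ≤ ((m.choose 2 : ℕ) : ℝ) - (m * k : ℕ) := by
    rw [hchoose]
    push_cast
    have h1 : (ε * n / 4) ^ 2 ≤ (m : ℝ) ^ 2 := by gcongr
    nlinarith
  have hle : m * k ≤ m.choose 2 := by
    have : ((m * k : ℕ) : ℝ) ≤ (m.choose 2 : ℕ) := by
      have : 0 ≤ (ε * n) ^ 2 / 64 := by positivity
      linarith
    exact_mod_cast this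
  have e0 : EdgeOrdering n := (Fintype.equivFin (CEdge n)).symm
  have hlog0 : 0 ≤ Real.log n := Real.log_nonneg (by linarith)
  have hexp : ε ^ 3 / 256 * Real.log n * n ≤
      (1 - 1 / 2) * (((m.choose 2 : ℕ) : ℝ) - (m * k : ℕ)) / (n * (n - 1) / 2) * t₁ := by
    calc ε ^ 3 / 256 * Real.log n * n
        = (1 - 1 / 2) * ((ε * n) ^ 2 / 64) / (n * n / 2) * (ε / 4 * (n * Real.log n)) := by
          field_simp
          ring
      _ ≤ _ := by
          have h1 : (0 : ℝ) < n - 1 := by linarith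
          have h2 : 0 ≤ ((m.choose 2 : ℕ) : ℝ) - (m * k : ℕ) := le_trans (by positivity) hgap
          have h3 : (0 : ℝ) ≤ 1 - 1 / 2 := by norm_num
          gcongr
          linarith
  refine (uprob_exists_le _ _ (c := ((1 / 2 : ℝ) ^ (m * k))⁻¹ *
    Real.exp (-(ε ^ 3 / 256 * Real.log n * n))) fun U hU => ?_).trans ?_
  · have hUm := (Finset.mem_powersetCard.1 hU).2
    refine (uprob_hits_lt_le e0 (edgesIn U) (r := m * k) (by rwa [card_edgesIn, hUm])
      (x := 1 / 2) (by norm_num) (by norm_num) _).trans ?_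
    rw [card_window htN, card_edgesIn, hUm, Fintype.card_fin, cast_card_cedge, Nat.sub_zero]
    gcongr
  · have h2 : (2 : ℝ) ≤ Real.exp 1 := by
      have := Real.add_one_le_exp 1
      linarith
    have h3 : ((Finset.powersetCard m (Finset.univ : Finset (Fin n))).card : ℝ) ≤ Real.exp n := by
      rw [Finset.card_powersetCard, Finset.card_univ, Fintype.card_fin]
      calc ((n.choose m : ℕ) : ℝ) ≤ 2 ^ n := by exact_mod_cast Nat.choose_le_two_pow n m
        _ ≤ Real.exp 1 ^ n := by gcongr
        _ = Real.exp n := by rw [← Real.exp_nat_mul, mul_one]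
    have h4 : ((1 / 2 : ℝ) ^ (m * k))⁻¹ ≤ Real.exp (k * ε / 2 * n) := by
      calc ((1 / 2 : ℝ) ^ (m * k))⁻¹ = 2 ^ (m * k) := by simp
        _ ≤ Real.exp 1 ^ (m * k) := by gcongr
        _ = Real.exp (m * k) := by rw [← Real.exp_nat_mul, mul_one]; push_cast; rfl
        _ ≤ _ := by
          refine Real.exp_le_exp.2 ?_
          nlinarith
    calc _ ≤ Real.exp n * (Real.exp (k * ε / 2 * n) *
          Real.exp (-(ε ^ 3 / 256 * Real.log n * n))) := by gcongr
      _ ≤ Real.exp (-n) := by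
        rw [← Real.exp_add, ← Real.exp_add]
        gcongr
        nlinarith

/-- Every vertex receives at least `k` edges between times `t₁` and `T`, with probability
polynomially close to one. -/
lemma uprob_hits_edgesAt_le {n k t₁ T : ℕ} {ε : ℝ} (hε : 0 < ε) (hn : 2 ≤ n)
    (htT : t₁ ≤ T) (hTN : T ≤ Fintype.card (CEdge n))
    (hT : (1 / 2 + ε / 8) * (n * Real.log n) ≤ (T : ℝ) - t₁)
    (hk : (k : ℝ) ≤ ε / (16 + 4 * ε) * (n - 1)) :
    uprob (fun ω : EdgeOrdering n => ∃ v ∈ (Finset.univ : Finset (Fin n)),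
      hits (edgesAt v) (window _ t₁ T) ω < k) ≤
      ((ε / (16 + 4 * ε)) ^ k)⁻¹ * Real.exp (-(ε / 8 * Real.log n)) := by
  set x := ε / (16 + 4 * ε) with hx
  have hx0 : 0 < x := by positivity
  have hx1 : x ≤ 1 / 4 := by
    rw [hx, div_le_iff₀ (by positivity)]
    linarith
  have hxε : (1 - 2 * x) * (1 + ε / 4) = 1 + ε / 8 := by
    rw [hx]
    field_simp
    ring
  have hn' : (2 : ℝ) ≤ n := by exact_mod_cast hn
  have hn1 : (0 : ℝ) < n - 1 := by linarith
  have hcast : ((n - 1 : ℕ) : ℝ) = n - 1 := by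
    rw [Nat.cast_sub (by omega), Nat.cast_one]
  have hle : k ≤ n - 1 := by
    have : (k : ℝ) ≤ (n - 1 : ℕ) := by
      rw [hcast]
      nlinarith
    exact_mod_cast this
  have e0 : EdgeOrdering n := (Fintype.equivFin (CEdge n)).symm
  have hlog0 : 0 ≤ Real.log n := Real.log_nonneg (by linarith)
  have hexp : (1 + ε / 8) * Real.log n ≤
      (1 - x) * ((n - 1 : ℝ) - k) / (n * (n - 1) / 2) * ((T : ℝ) - t₁) := by
    calc (1 + ε / 8) * Real.log n = (1 - 2 * x) * (1 + ε / 4) * Real.log n := by rw [hxε]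
      _ ≤ (1 - x) * (1 - x) * (1 + ε / 4) * Real.log n := by
          gcongr
          nlinarith
      _ = (1 - x) * ((1 - x) * (n - 1)) / (n * (n - 1) / 2) *
            ((1 / 2 + ε / 8) * (n * Real.log n)) := by
          field_simp
          ring
      _ ≤ _ := by
          have : 0 ≤ 1 - x := by linarith
          have : 0 ≤ (n - 1 : ℝ) - k := by nlinarith
          gcongr
          linarith
  refine (uprob_exists_le _ _ (c := (x ^ k)⁻¹ *
    Real.exp (-((1 + ε / 8) * Real.log n))) fun v _ => ?_).trans ?_
  · refine (uprob_hits_lt_le e0 (edgesAt v) (r := k) (by rwa [card_edgesAt])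
      (x := x) hx0 (by linarith) _).trans ?_
    rw [card_window hTN, card_edgesAt, Fintype.card_fin, cast_card_cedge, Nat.cast_sub htT, hcast]
    gcongr
  · have h1 : (n : ℝ) = Real.exp (Real.log n) := (Real.exp_log (by linarith)).symm
    rw [Finset.card_univ, Fintype.card_fin]
    calc (n : ℝ) * ((x ^ k)⁻¹ * Real.exp (-((1 + ε / 8) * Real.log n)))
        = (x ^ k)⁻¹ * (Real.exp (Real.log n) * Real.exp (-((1 + ε / 8) * Real.log n))) := by
          rw [← h1]; ring
      _ ≤ _ := by
          rw [← Real.exp_add]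
          gcongr
          linarith

/-- Minimum degree: if `t ≥ (1+ε) n log n / 2` and `b ≥ (1+ε) k n / 2`, Builder has a
`(t,b)`-strategy achieving minimum degree at least `k` with high probability. -/
theorem stmt1 (k : ℕ) (hk : 0 < k) (ε : ℝ) (hε : 0 < ε) (t b : ℕ → ℕ)
    (ht : ∀ n : ℕ, (1 + ε) * n * Real.log n / 2 ≤ (t n : ℝ))
    (hb : ∀ n : ℕ, (1 + ε) * k * n / 2 ≤ (b n : ℝ)) :
    ∃ S : (n : ℕ) → Strategy n,
      Tendsto
        (fun n => uprob (fun ω : EdgeOrdering n =>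
          ∀ v : Fin n, k ≤ edegree n (build n (b n) (S n) ω (t n)) v))
        atTop (nhds 1) := by
  set x := ε / (16 + 4 * ε) with hx
  have hx0 : 0 < x := by positivity
  set t₁ : ℕ → ℕ := fun n => ⌈ε / 4 * (n * Real.log n)⌉₊ with ht₁
  set T : ℕ → ℕ := fun n => ⌈(1 + ε) * n * Real.log n / 2⌉₊ with hT
  set m : ℕ → ℕ := fun n => ⌊ε * n / 2⌋₊ with hm
  refine ⟨fun n => twoPhase n k (t₁ n), ?_⟩
  have hcast : Tendsto (fun n : ℕ => (n : ℝ)) atTop atTop := tendsto_natCast_atTop_atTop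
  have hlog : Tendsto (fun n : ℕ => Real.log n) atTop atTop := Real.tendsto_log_atTop.comp hcast
  have hlim : Tendsto (fun n : ℕ => 1 - (Real.exp (-n) +
      (x ^ k)⁻¹ * Real.exp (-(ε / 8 * Real.log n)))) atTop (nhds 1) := by
    have h1 : Tendsto (fun n : ℕ => Real.exp (-(n : ℝ))) atTop (nhds 0) :=
      Real.tendsto_exp_neg_atTop_nhds_zero.comp hcast
    have h2 : Tendsto (fun n : ℕ => Real.exp (-(ε / 8 * Real.log n))) atTop (nhds 0) :=
      Real.tendsto_exp_neg_atTop_nhds_zero.comp (hlog.const_mul_atTop (by positivity))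
    simpa using (h1.add (h2.const_mul (x ^ k)⁻¹)).const_sub 1
  have hlogle : ∀ᶠ n : ℕ in atTop, 2 * (1 + ε) * Real.log n ≤ n := by
    have h := (Real.isLittleO_log_id_atTop.comp_tendsto hcast).bound
      (c := 1 / (2 * (1 + ε))) (by positivity)
    filter_upwards [h] with n hn
    have hn' : Real.log n ≤ 1 / (2 * (1 + ε)) * n := by
      simpa using (le_abs_self _).trans hn
    rw [div_mul_eq_mul_div, one_mul, le_div_iff₀ (by positivity)] at hn'
    linarith
  refine tendsto_of_tendsto_of_tendsto_of_le_of_le' hlim tendsto_const_nhds ?_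
    (Eventually.of_forall fun n => uprob_le_one _)
  filter_upwards [hlogle, hlog.eventually_ge_atTop 1, hcast.eventually_ge_atTop 2,
    hcast.eventually_ge_atTop (8 / ε), (hlog.const_mul_atTop (show 0 < ε ^ 3 / 256 by
      positivity)).eventually_ge_atTop (2 + k * ε / 2),
    hcast.eventually_ge_atTop (k / x + 1),
    hcast.eventually_ge_atTop ((4 * k + 2) * 4 / ε)] with n hlogn hlog1 hn2 hn8 hlogk hnk hnm
  have hn2' : 2 ≤ n := by exact_mod_cast hn2
  have hεn : 8 ≤ ε * n := by rwa [div_le_iff₀' hε] at hn8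
  have hnL : (n : ℝ) ≤ n * Real.log n := by nlinarith
  have hTt : T n ≤ t n := Nat.ceil_le.2 (ht n)
  have htT : t₁ n ≤ T n := Nat.ceil_mono (by nlinarith)
  have hTN : T n ≤ Fintype.card (CEdge n) := by
    refine Nat.ceil_le.2 ?_
    rw [cast_card_cedge]
    nlinarith
  have hm_le : (m n : ℝ) ≤ ε * n / 2 := Nat.floor_le (by positivity)
  have hm_ge : ε * n / 4 ≤ m n := by
    have := Nat.lt_floor_add_one (ε * n / 2)
    change ε * n / 2 < m n + 1 at this
    linarith
  have hmk : 4 * k + 2 ≤ m n := by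
    rw [div_le_iff₀' hε] at hnm
    have : (4 * k + 2 : ℝ) ≤ m n := by linarith
    exact_mod_cast this
  have hgap : (1 / 2 + ε / 8) * (n * Real.log n) ≤ (T n : ℝ) - t₁ n := by
    have h1 : (1 + ε) * n * Real.log n / 2 ≤ T n := Nat.le_ceil _
    have h2 : (t₁ n : ℝ) < ε / 4 * (n * Real.log n) + 1 := Nat.ceil_lt_add_one (by positivity)
    nlinarith
  have hkx : (k : ℝ) ≤ x * (n - 1) := by
    rw [← div_le_iff₀' hx0]
    linarith
  have hbud : n * k + 2 * (m n * k) ≤ 2 * b n := by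
    have : (n * k + 2 * (m n * k) : ℝ) ≤ 2 * b n := by
      have := hb n
      have : (m n : ℝ) * k ≤ ε * n / 2 * k := by gcongr
      linarith
    exact_mod_cast this
  have hbad1 := uprob_hits_edgesIn_le hε hn2' hm_le hm_ge hmk (Nat.le_ceil _ : _ ≤ (t₁ n : ℝ))
    (htT.trans hTN) hlogk
  have hbad2 := uprob_hits_edgesAt_le hε hn2' htT hTN hgap hkx
  have : Nonempty (EdgeOrdering n) := ⟨(Fintype.equivFin (CEdge n)).symm⟩
  refine (sub_le_sub_left ((uprob_or_le _ _).trans (add_le_add hbad1 hbad2)) 1).trans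
    (one_sub_uprob_le fun ω hω v => ?_)
  push Not at hω
  exact (le_edegree_build_twoPhase hk (by omega) hbud
    (fun U hU => (hω.1 U hU).not_gt) (fun v hv => (hω.2 v hv).not_gt) v).trans
    (edegree_mono (build_mono hTt) v)
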